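/- arXiv:1403.7135 — 18 statements merged into one kernel-verified Lean document; each statement's English description precedes it below -/
import Mathlib

section
/- For every x ∈ X and every c ∈ C, one has ‖x − Gx‖² + ‖Gx − c‖² ≤ ‖x − c‖². -/
open RealInnerProductSpace

theorem subgradient_projector_fejer_inequality
    {X : Type*} [NormedAddCommGroup X] [InnerProductSpace ℝ X] [CompleteSpace X]
    (f : X → ℝ) (hconv : ConvexOn ℝ Set.univ f) (hcont : Continuous f)
    (hC : {x : X | f x ≤ 0}.Nonempty)
    (s : X → X) (hs : ∀ x y : X, f x + ⟪s x, y - x⟫ ≤ f y)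
    (G : X → X)
    (hG : ∀ x : X, G x = if 0 < f x then x - (f x / ‖s x‖ ^ 2) • s x else x) :
    ∀ x c : X, f c ≤ 0 → ‖x - G x‖ ^ 2 + ‖G x - c‖ ^ 2 ≤ ‖x - c‖ ^ 2 := by
  intro x c hc
  rw [hG]
  split_ifs with hx
  · set t := f x / ‖s x‖ ^ 2
    have ht0 : 0 ≤ t := by positivity
    have hle : t * ‖s x‖ ^ 2 ≤ f x := by
      rcases eq_or_ne (‖s x‖ ^ 2) 0 with h | h
      · rw [h, mul_zero]
        exact hx.le
      · exact (div_mul_cancel₀ _ h).le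
    have hsub : f x ≤ ⟪x - c, s x⟫ := by
      have h := hs x c
      rw [← neg_sub x c, inner_neg_right, real_inner_comm] at h
      linarith
    have hstep : ‖x - (x - t • s x)‖ ^ 2 = t ^ 2 * ‖s x‖ ^ 2 := by
      rw [sub_sub_cancel, norm_smul, mul_pow, Real.norm_eq_abs, sq_abs]
    have hexp : ‖x - t • s x - c‖ ^ 2 =
        ‖x - c‖ ^ 2 - 2 * (t * ⟪x - c, s x⟫) + t ^ 2 * ‖s x‖ ^ 2 := by
      rw [sub_right_comm, norm_sub_sq_real, real_inner_smul_right, norm_smul, mul_pow,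
        Real.norm_eq_abs, sq_abs]
    rw [hstep, hexp]
    nlinarith [mul_le_mul_of_nonneg_left (hle.trans hsub) ht0]
  · simp
end

section
/- If x ∈ X satisfies f(x) > 0, then for every c ∈ C one has f(x)²/‖s(x)‖² + ‖Gx − c‖² ≤ ‖x − c‖². -/
open RealInnerProductSpace

theorem subgradient_projector_sharp_fejer_inequality
    {X : Type*} [NormedAddCommGroup X] [InnerProductSpace ℝ X] [CompleteSpace X]
    (f : X → ℝ) (hconv : ConvexOn ℝ Set.univ f) (hcont : Continuous f)
    (hC : {x : X | f x ≤ 0}.Nonempty)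
    (s : X → X) (hs : ∀ x y : X, f x + ⟪s x, y - x⟫ ≤ f y)
    (G : X → X)
    (hG : ∀ x : X, G x = if 0 < f x then x - (f x / ‖s x‖ ^ 2) • s x else x)
    (x : X) (hx : 0 < f x) :
    ∀ c : X, f c ≤ 0 → f x ^ 2 / ‖s x‖ ^ 2 + ‖G x - c‖ ^ 2 ≤ ‖x - c‖ ^ 2 := by
  intro c hc
  have h := hs x c
  have hneg : ⟪s x, c - x⟫ = -⟪x - c, s x⟫ := by
    rw [← neg_sub x c, inner_neg_right, real_inner_comm]
  have hinner : f x ≤ ⟪x - c, s x⟫ := by linarith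
  have hs_ne : s x ≠ 0 := by
    intro h0
    rw [h0, inner_zero_right] at hinner
    linarith
  have hpos : 0 < ‖s x‖ := norm_pos_iff.mpr hs_ne
  rw [hG x, if_pos hx, sub_right_comm, norm_sub_sq_real, inner_smul_right, norm_smul, mul_pow,
    Real.norm_eq_abs, sq_abs]
  have hmul := mul_le_mul_of_nonneg_left hinner (div_nonneg hx.le (sq_nonneg ‖s x‖))
  have hstep : f x / ‖s x‖ ^ 2 * f x = f x ^ 2 / ‖s x‖ ^ 2 := by ring
  have hsq : (f x / ‖s x‖ ^ 2) ^ 2 * ‖s x‖ ^ 2 = f x ^ 2 / ‖s x‖ ^ 2 := by field_simp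
  linarith
end

section
/- Suppose in addition that min f(X) = 0, that f is Fréchet differentiable on all of X with gradient ∇f Lipschitz continuous with constant L > 0 (so the selection is s = ∇f), that x ∈ X satisfies f(x) > 0, and that there exists α > 0 such that f(x) ≥ α·d_C(x)², where d_C denotes the distance function to C. Then d_C(Gx)² ≤ (1 − α²/L²)·d_C(x)². -/
open RealInnerProductSpace

theorem HasGradientAt.eq_zero_of_isLocalMin {X : Type*} [NormedAddCommGroup X]
    [InnerProductSpace ℝ X] [CompleteSpace X] {f : X → ℝ} {g c : X}
    (hg : HasGradientAt f g c) (hc : IsLocalMin f c) : g = 0 := by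
  simpa using hc.hasFDerivAt_eq_zero hg.hasFDerivAt

/-- The step `x ↦ x - (v / ‖g‖ ^ 2) • g` decreases the squared distance to any point `c` with
`v ≤ ⟪g, x - c⟫` by at least `(v / ‖g‖) ^ 2`. -/
theorem norm_sub_smul_sub_sq_le_of_le_inner {X : Type*} [NormedAddCommGroup X]
    [InnerProductSpace ℝ X] {x c g : X} {v : ℝ} (hg : g ≠ 0) (hv : 0 ≤ v)
    (h : v ≤ ⟪g, x - c⟫) :
    ‖x - (v / ‖g‖ ^ 2) • g - c‖ ^ 2 ≤ ‖x - c‖ ^ 2 - (v / ‖g‖) ^ 2 := by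
  have hpos : 0 < ‖g‖ := norm_pos_iff.mpr hg
  have hmul : v / ‖g‖ ^ 2 * v ≤ v / ‖g‖ ^ 2 * ⟪g, x - c⟫ := by gcongr
  have hstep : v / ‖g‖ ^ 2 * v = (v / ‖g‖) ^ 2 := by ring
  have hlen : (v / ‖g‖ ^ 2 * ‖g‖) ^ 2 = (v / ‖g‖) ^ 2 := by field_simp
  rw [sub_right_comm, norm_sub_sq_real, norm_smul, real_inner_smul_right, Real.norm_eq_abs,
    abs_of_nonneg (by positivity), real_inner_comm, hlen]
  linarith

theorem Metric.le_infDist_sq {X : Type*} [PseudoMetricSpace X] {C : Set X} (hC : C.Nonempty)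
    {x : X} {b : ℝ} (h : ∀ c ∈ C, b ≤ dist x c ^ 2) : b ≤ Metric.infDist x C ^ 2 :=
  (Real.sqrt_le_left Metric.infDist_nonneg).mp <|
    (Metric.le_infDist hC).mpr fun c hc => (Real.sqrt_le_left dist_nonneg).mpr (h c hc)

theorem subgradient_projector_linear_rate_of_distance_decrease
    {X : Type*} [NormedAddCommGroup X] [InnerProductSpace ℝ X] [CompleteSpace X]
    (f : X → ℝ) (hconv : ConvexOn ℝ Set.univ f) (hcont : Continuous f)
    (hC : {x : X | f x ≤ 0}.Nonempty)
    (s : X → X) (hs : ∀ x y : X, f x + ⟪s x, y - x⟫ ≤ f y)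
    (G : X → X)
    (hG : ∀ x : X, G x = if 0 < f x then x - (f x / ‖s x‖ ^ 2) • s x else x)
    (hfnonneg : ∀ x : X, 0 ≤ f x) (hattain : ∃ x : X, f x = 0)
    (hgrad : ∀ x : X, HasGradientAt f (s x) x)
    (L : ℝ) (hL : 0 < L) (hLip : ∀ x y : X, ‖s x - s y‖ ≤ L * ‖x - y‖)
    (x : X) (hx : 0 < f x)
    (α : ℝ) (hα : 0 < α)
    (hgrowth : α * Metric.infDist x {z : X | f z ≤ 0} ^ 2 ≤ f x) :
    Metric.infDist (G x) {z : X | f z ≤ 0} ^ 2 ≤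
      (1 - α ^ 2 / L ^ 2) * Metric.infDist x {z : X | f z ≤ 0} ^ 2 := by
  set C := {z : X | f z ≤ 0}
  have hgx : ∀ c ∈ C, ‖s x‖ ≤ L * dist x c := by
    intro c hc
    have hmin : IsLocalMin f c :=
      Filter.Eventually.of_forall fun y => le_trans hc (hfnonneg y)
    simpa [(hgrad c).eq_zero_of_isLocalMin hmin, dist_eq_norm] using hLip x c
  have hinner : ∀ c ∈ C, f x ≤ ⟪s x, x - c⟫ := by
    intro c hc
    have hsub := hs x c
    rw [← neg_sub x c, inner_neg_right] at hsub
    have hfc : f c ≤ 0 := hc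
    linarith
  have hsx : s x ≠ 0 := by
    intro h0
    obtain ⟨c, hc⟩ := hC
    have := hinner c hc
    rw [h0, inner_zero_left] at this
    linarith
  have hpos : 0 < ‖s x‖ := norm_pos_iff.mpr hsx
  have hnorm : ‖s x‖ ≤ L * Metric.infDist x C := by
    rw [← div_le_iff₀' hL]
    exact (Metric.le_infDist hC).mpr fun c hc => (div_le_iff₀' hL).mpr (hgx c hc)
  have hdecrease : Metric.infDist (G x) C ^ 2 + (f x / ‖s x‖) ^ 2 ≤ Metric.infDist x C ^ 2 := by
    refine Metric.le_infDist_sq hC fun c hc => ?_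
    have hle : Metric.infDist (G x) C ^ 2 ≤ dist (G x) c ^ 2 :=
      pow_le_pow_left₀ Metric.infDist_nonneg (Metric.infDist_le_dist_of_mem hc) 2
    have hstep := norm_sub_smul_sub_sq_le_of_le_inner hsx hx.le (hinner c hc)
    rw [dist_eq_norm, hG x, if_pos hx] at hle
    rw [dist_eq_norm, hG x, if_pos hx]
    linarith
  have hd : 0 ≤ Metric.infDist x C := Metric.infDist_nonneg
  have hratio : α / L * Metric.infDist x C ≤ f x / ‖s x‖ := by
    rw [le_div_iff₀ hpos]
    calc α / L * Metric.infDist x C * ‖s x‖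
        ≤ α / L * Metric.infDist x C * (L * Metric.infDist x C) := by gcongr
      _ = α * Metric.infDist x C ^ 2 := by field_simp
      _ ≤ f x := hgrowth
  have hsq := pow_le_pow_left₀ (by positivity) hratio 2
  rw [mul_pow, div_pow] at hsq
  linarith
end

section
/- Suppose in addition that min f(X) = 0, that x ∈ X satisfies f(x) > 0, and that there exists α > 0 such that f(x) ≥ α·d_C(x), where d_C denotes the distance function to C. Then d_C(Gx)² ≤ (1 − α²/‖s(x)‖²)·d_C(x)². -/
open RealInnerProductSpace

/-- The point `x - (t / ‖u‖²) • u` is `x` moved onto the hyperplane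
at height `⟪u, x⟫ - t`; this brings it closer to every point `c` on or beyond that hyperplane. -/
theorem norm_sub_div_smul_sub_sq_add_le {X : Type*} [NormedAddCommGroup X]
    [InnerProductSpace ℝ X] {u x c : X} {t : ℝ} (hu : u ≠ 0) (ht : 0 ≤ t)
    (h : t ≤ ⟪u, x - c⟫) :
    ‖x - (t / ‖u‖ ^ 2) • u - c‖ ^ 2 + t ^ 2 / ‖u‖ ^ 2 ≤ ‖x - c‖ ^ 2 := by
  have hpos : 0 < ‖u‖ ^ 2 := by positivity
  have key : ‖(t / ‖u‖ ^ 2) • u‖ ^ 2 = t ^ 2 / ‖u‖ ^ 2 := by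
    rw [norm_smul, mul_pow, Real.norm_eq_abs, sq_abs]
    field_simp
  have hmul : t ^ 2 / ‖u‖ ^ 2 ≤ t / ‖u‖ ^ 2 * ⟪u, x - c⟫ := by
    calc t ^ 2 / ‖u‖ ^ 2 = t / ‖u‖ ^ 2 * t := by ring
      _ ≤ _ := by gcongr
  rw [sub_right_comm, norm_sub_sq_real, key, real_inner_smul_right, real_inner_comm]
  linarith

/-- If the squared distances from `y` to the points of `C` are smaller by at least `q` than those
from `x`, then so are the squared distances to `C`. -/
theorem infDist_sq_add_le_of_forall_dist_sq_add_le {X : Type*} [PseudoMetricSpace X]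
    {C : Set X} (hC : C.Nonempty) {x y : X} {q : ℝ}
    (h : ∀ c ∈ C, dist y c ^ 2 + q ≤ dist x c ^ 2) :
    Metric.infDist y C ^ 2 + q ≤ Metric.infDist x C ^ 2 := by
  have hsqrt : √(Metric.infDist y C ^ 2 + q) ≤ Metric.infDist x C := by
    refine (Metric.le_infDist hC).2 fun {c} hc => Real.sqrt_le_iff.2 ⟨dist_nonneg, ?_⟩
    have hle : Metric.infDist y C ^ 2 ≤ dist y c ^ 2 :=
      pow_le_pow_left₀ Metric.infDist_nonneg (Metric.infDist_le_dist_of_mem hc) 2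
    linarith [h c hc]
  exact (Real.sqrt_le_iff.1 hsqrt).2

theorem subgradient_projector_distance_decrease_linear_growth
    {X : Type*} [NormedAddCommGroup X] [InnerProductSpace ℝ X] [CompleteSpace X]
    (f : X → ℝ) (hconv : ConvexOn ℝ Set.univ f) (hcont : Continuous f)
    (hC : {x : X | f x ≤ 0}.Nonempty)
    (s : X → X) (hs : ∀ x y : X, f x + ⟪s x, y - x⟫ ≤ f y)
    (G : X → X)
    (hG : ∀ x : X, G x = if 0 < f x then x - (f x / ‖s x‖ ^ 2) • s x else x)
    (hfnonneg : ∀ x : X, 0 ≤ f x) (hattain : ∃ x : X, f x = 0)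
    (x : X) (hx : 0 < f x)
    (α : ℝ) (hα : 0 < α)
    (hgrowth : α * Metric.infDist x {z : X | f z ≤ 0} ≤ f x) :
    Metric.infDist (G x) {z : X | f z ≤ 0} ^ 2 ≤
      (1 - α ^ 2 / ‖s x‖ ^ 2) * Metric.infDist x {z : X | f z ≤ 0} ^ 2 := by
  have hsx : s x ≠ 0 := by
    intro h0
    obtain ⟨c, hc⟩ := hC
    have h := hs x c
    rw [h0, inner_zero_left, add_zero] at h
    exact absurd (hx.trans_le h) (not_lt.2 hc)
  have hdecrease : Metric.infDist (G x) {z : X | f z ≤ 0} ^ 2 + f x ^ 2 / ‖s x‖ ^ 2 ≤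
      Metric.infDist x {z : X | f z ≤ 0} ^ 2 := by
    refine infDist_sq_add_le_of_forall_dist_sq_add_le hC fun c hc => ?_
    rw [dist_eq_norm, dist_eq_norm, hG x, if_pos hx]
    refine norm_sub_div_smul_sub_sq_add_le hsx hx.le ?_
    have h := hs x c
    rw [← neg_sub x c, inner_neg_right] at h
    have hfc : f c ≤ 0 := hc
    linarith
  have hlower : (α * Metric.infDist x {z : X | f z ≤ 0}) ^ 2 / ‖s x‖ ^ 2 ≤
      f x ^ 2 / ‖s x‖ ^ 2 := by
    have := mul_nonneg hα.le (Metric.infDist_nonneg (x := x) (s := {z : X | f z ≤ 0}))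
    gcongr
  rw [mul_pow, mul_div_right_comm] at hlower
  linarith
end

section
/- Suppose in addition that f ≥ 0, let α > 0, and suppose that g = f^α is convex. Then {x ∈ X : g(x) ≤ 0} = C, and for every x ∈ X with f(x) > 0 the set-valued subgradient projector satisfies 𝒢_g(x) = (1 − 1/α)·x + (1/α)·𝒢_f(x), i.e. {x − (g(x)/‖u‖²)·u : u a subgradient of g at x} = {(1 − 1/α)·x + (1/α)·(x − (f(x)/‖v‖²)·v) : v a subgradient of f at x}. -/
open RealInnerProductSpace

/-- Chain rule for subgradients of a convex power `h ^ β`; convexity of `h` itself is not needed. -/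
theorem subgradient_rpow {X : Type*} [NormedAddCommGroup X] [InnerProductSpace ℝ X]
    {h : X → ℝ} {β : ℝ} (hβ : 0 < β) (hconv : ConvexOn ℝ Set.univ fun x => h x ^ β)
    {x v : X} (hx : 0 < h x) (hv : ∀ y : X, h x + ⟪v, y - x⟫ ≤ h y) (y : X) :
    h x ^ β + ⟪(β * h x ^ (β - 1)) • v, y - x⟫ ≤ h y ^ β := by
  set c : ℝ := ⟪v, y - x⟫ with hc
  have hlin : HasDerivAt (fun t : ℝ => h x + t * c) c 0 := by
    simpa using ((hasDerivAt_id (0 : ℝ)).mul_const c).const_add (h x)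
  have hder : HasDerivAt (fun t : ℝ => (h x + t * c) ^ β) (c * β * h x ^ (β - 1)) 0 := by
    simpa using hlin.rpow_const (p := β) (Or.inl (by simpa using hx.ne'))
  have hpos : ∀ᶠ t in nhds (0 : ℝ), 0 < h x + t * c :=
    hlin.continuousAt.eventually_const_lt (by simpa using hx)
  have hlim := hder.tendsto_slope_zero_right
  have hbound : c * β * h x ^ (β - 1) ≤ h y ^ β - h x ^ β := by
    refine le_of_tendsto hlim ?_
    filter_upwards [self_mem_nhdsWithin, nhdsWithin_le_nhds hpos,
      nhdsWithin_le_nhds (eventually_lt_nhds one_pos)] with t ht htpos ht1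
    have ht : 0 < t := ht
    have hsub : h x + t * c ≤ h ((1 - t) • x + t • y) := by
      have heq : (1 - t) • x + t • y - x = t • (y - x) := by module
      simpa [heq, inner_smul_right, hc] using hv ((1 - t) • x + t • y)
    have hpow := Real.rpow_le_rpow htpos.le hsub hβ.le
    have hcv := hconv.2 (Set.mem_univ x) (Set.mem_univ y) (sub_nonneg.2 ht1.le) ht.le
      (sub_add_cancel 1 t)
    simp only [smul_eq_mul, zero_add, zero_mul, add_zero] at hcv ⊢
    rw [inv_mul_le_iff₀ ht]
    linarith
  rw [real_inner_smul_left]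
  linarith

theorem div_norm_sq_smul_smul {X : Type*} [NormedAddCommGroup X] [InnerProductSpace ℝ X]
    (a : ℝ) {k : ℝ} (hk : k ≠ 0) (v : X) :
    (a / ‖k • v‖ ^ 2) • k • v = (a / k / ‖v‖ ^ 2) • v := by
  rcases eq_or_ne v 0 with rfl | hv
  · simp
  have hv' : ‖v‖ ≠ 0 := norm_ne_zero_iff.2 hv
  rw [smul_smul, norm_smul, mul_pow, Real.norm_eq_abs, sq_abs]
  congr 1
  field_simp

theorem subgradient_projector_of_power
    {X : Type*} [NormedAddCommGroup X] [InnerProductSpace ℝ X] [CompleteSpace X]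
    (f : X → ℝ) (hconv : ConvexOn ℝ Set.univ f) (hcont : Continuous f)
    (hC : {x : X | f x ≤ 0}.Nonempty)
    (hfnonneg : ∀ x : X, 0 ≤ f x)
    (α : ℝ) (hα : 0 < α)
    (g : X → ℝ) (hg : ∀ x : X, g x = f x ^ α)
    (hgconv : ConvexOn ℝ Set.univ g) :
    {x : X | g x ≤ 0} = {x : X | f x ≤ 0} ∧
      ∀ x : X, 0 < f x →
        {w : X | ∃ u : X, (∀ y : X, g x + ⟪u, y - x⟫ ≤ g y) ∧
            w = x - (g x / ‖u‖ ^ 2) • u} =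
        {w : X | ∃ v : X, (∀ y : X, f x + ⟪v, y - x⟫ ≤ f y) ∧
            w = (1 - 1 / α) • x + (1 / α) • (x - (f x / ‖v‖ ^ 2) • v)} := by
  have hfg : ∀ x, g x ^ α⁻¹ = f x := fun x => by
    rw [hg, Real.rpow_rpow_inv (hfnonneg x) hα.ne']
  refine ⟨?_, fun x hx => ?_⟩
  · ext x
    simp only [Set.mem_ofPred_eq]
    refine ⟨fun h => not_lt.1 fun hx => ?_, fun h => ?_⟩
    · exact (Real.rpow_pos_of_pos hx α).not_ge (hg x ▸ h)
    · rw [hg, le_antisymm h (hfnonneg x), Real.zero_rpow hα.ne']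
  have hgx : 0 < g x := hg x ▸ Real.rpow_pos_of_pos hx α
  have hcomb : ∀ z : X, (1 - 1 / α) • x + (1 / α) • (x - z) = x - α⁻¹ • z := fun z => by
    module
  ext w
  simp only [Set.mem_ofPred_eq, hcomb, smul_smul]
  constructor
  · rintro ⟨u, hu, rfl⟩
    refine ⟨(α⁻¹ * g x ^ (α⁻¹ - 1)) • u, fun y => ?_, ?_⟩
    · simpa only [hfg] using
        subgradient_rpow (inv_pos.2 hα) (by simpa only [hfg] using hconv) hgx hu y
    · have hk : α⁻¹ * g x ^ (α⁻¹ - 1) ≠ 0 := by positivity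
      rw [← smul_smul α⁻¹ (f x / _), div_norm_sq_smul_smul _ hk, smul_smul]
      congr 2
      rw [Real.rpow_sub_one hgx.ne', hfg]
      field_simp
  · rintro ⟨v, hv, rfl⟩
    refine ⟨(α * f x ^ (α - 1)) • v, fun y => ?_, ?_⟩
    · simpa only [← hg] using
        subgradient_rpow hα (by simpa only [← hg] using hgconv) hx hv y
    · have hk : α * f x ^ (α - 1) ≠ 0 := by positivity
      rw [div_norm_sq_smul_smul _ hk]
      congr 2
      rw [Real.rpow_sub_one hx.ne', ← hg]
      field_simp
end

section
/- Let A : X → X be a continuous linear operator with A*A = AA* = Id (where A* is the adjoint), and let g = f ∘ A. Then {x ∈ X : g(x) ≤ 0} = A*(C), and for every x ∈ X with g(x) > 0 the set-valued subgradient projector satisfies 𝒢_g(x) = A*(𝒢_f(Ax)), i.e. {x − (g(x)/‖u‖²)·u : u a subgradient of g at x} = {A*w : w ∈ 𝒢_f(Ax)}. -/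
open RealInnerProductSpace

theorem subgradient_projector_of_unitary_composition
    {X : Type*} [NormedAddCommGroup X] [InnerProductSpace ℝ X] [CompleteSpace X]
    (f : X → ℝ) (hconv : ConvexOn ℝ Set.univ f) (hcont : Continuous f)
    (hC : {x : X | f x ≤ 0}.Nonempty)
    (A : X →L[ℝ] X)
    (hA1 : (ContinuousLinearMap.adjoint A).comp A = ContinuousLinearMap.id ℝ X)
    (hA2 : A.comp (ContinuousLinearMap.adjoint A) = ContinuousLinearMap.id ℝ X)
    (g : X → ℝ) (hg : ∀ x : X, g x = f (A x)) :
    {x : X | g x ≤ 0} = (ContinuousLinearMap.adjoint A) '' {x : X | f x ≤ 0} ∧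
      ∀ x : X, 0 < g x →
        {w : X | ∃ u : X, (∀ y : X, g x + ⟪u, y - x⟫ ≤ g y) ∧
            w = x - (g x / ‖u‖ ^ 2) • u} =
        (ContinuousLinearMap.adjoint A) ''
          {w : X | ∃ v : X, (∀ y : X, f (A x) + ⟪v, y - A x⟫ ≤ f y) ∧
              w = A x - (f (A x) / ‖v‖ ^ 2) • v} := by
  set B := ContinuousLinearMap.adjoint A
  have hBA : ∀ x, B (A x) = x := fun x => DFunLike.congr_fun hA1 x
  have hAB : ∀ x, A (B x) = x := fun x => DFunLike.congr_fun hA2 x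
  have inner_B : ∀ u y : X, ⟪B u, y⟫ = ⟪u, A y⟫ :=
    fun u y => ContinuousLinearMap.adjoint_inner_left A y u
  have norm_B : ∀ u, ‖B u‖ = ‖u‖ := fun u => by
    rw [← sq_eq_sq₀ (norm_nonneg _) (norm_nonneg _), ← real_inner_self_eq_norm_sq,
      ← real_inner_self_eq_norm_sq, inner_B, hAB]
  refine ⟨?_, fun x _ => ?_⟩
  · ext x
    constructor
    · intro hx
      exact ⟨A x, by simpa [hg] using hx, hBA x⟩
    · rintro ⟨y, hy, rfl⟩
      simpa [hg, hAB] using hy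
  · ext w
    constructor
    · rintro ⟨u, hu, rfl⟩
      refine ⟨_, ⟨A u, fun y => ?_, rfl⟩, ?_⟩
      · have h := hu (B y)
        rw [hg, hg, hAB, ← hBA u, inner_B, map_sub, hAB] at h
        exact h
      · rw [map_sub, map_smul, hBA, hBA, hg, ← norm_B (A u), hBA]
    · rintro ⟨_, ⟨v, hv, rfl⟩, rfl⟩
      refine ⟨B v, fun y => ?_, ?_⟩
      · rw [hg, hg, inner_B, map_sub]
        exact hv (A y)
      · rw [map_sub, map_smul, hBA, hg, norm_B]
end

section
/- Suppose f : X → ℝ is given by f(x) = ½‖x‖² if ‖x‖ ≤ 1 and f(x) = ‖x‖ − ½ otherwise (the Huber function), with selection s equal to its gradient: s(x) = x if ‖x‖ ≤ 1 and s(x) = x/‖x‖ otherwise. Then the subgradient projector satisfies G = ½·P, where P is the metric projection onto the closed unit ball of X, and G is firmly nonexpansive, i.e. ‖Gx − Gy‖² + ‖(Id − G)x − (Id − G)y‖² ≤ ‖x − y‖² for all x, y ∈ X. -/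
open RealInnerProductSpace

/-- The value of a subgradient projector step for the Huber function is half of the radial
projection onto the closed unit ball. -/
theorem huber_step_eq_half_unitBall_projection
    {X : Type*} [NormedAddCommGroup X] [InnerProductSpace ℝ X]
    {f : X → ℝ} (hf : ∀ x : X, f x = if ‖x‖ ≤ 1 then ‖x‖ ^ 2 / 2 else ‖x‖ - 1 / 2)
    {s : X → X} (hs : ∀ x : X, s x = if ‖x‖ ≤ 1 then x else ‖x‖⁻¹ • x) (x : X) :
    (if 0 < f x then x - (f x / ‖s x‖ ^ 2) • s x else x) = (1 / 2 : ℝ) • s x := by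
  by_cases h : ‖x‖ ≤ 1
  · rw [hf, hs, if_pos h, if_pos h]
    rcases eq_or_ne x 0 with rfl | h0
    · simp
    · have hn : 0 < ‖x‖ := norm_pos_iff.mpr h0
      have hc : ‖x‖ ^ 2 / 2 / ‖x‖ ^ 2 = 1 / 2 := by field_simp
      rw [if_pos (by positivity), hc]
      module
  · have h1 : 1 < ‖x‖ := not_le.mp h
    have hn : ‖x‖ ≠ 0 := by positivity
    have hu : ‖‖x‖⁻¹ • x‖ = 1 := by
      rw [norm_smul, norm_inv, norm_norm, inv_mul_cancel₀ hn]
    rw [hf, hs, if_neg h, if_neg h, if_pos (by linarith), hu]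
    have hx : x = ‖x‖ • (‖x‖⁻¹ • x) := by rw [smul_smul, mul_inv_cancel₀ hn, one_smul]
    nth_rewrite 1 [hx]
    module

/-- The radial projection onto the closed unit ball takes values in the ball. -/
theorem norm_unitBall_projection_le_one
    {X : Type*} [NormedAddCommGroup X] [InnerProductSpace ℝ X]
    {P : X → X} (hP : ∀ x : X, P x = if ‖x‖ ≤ 1 then x else ‖x‖⁻¹ • x) (x : X) :
    ‖P x‖ ≤ 1 := by
  rw [hP]
  split_ifs with h
  · exact h
  · rw [norm_smul, norm_inv, norm_norm]
    exact inv_mul_le_one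

/-- The variational inequality characterizing the projection onto the closed unit ball. -/
theorem inner_sub_unitBall_projection_nonneg
    {X : Type*} [NormedAddCommGroup X] [InnerProductSpace ℝ X]
    {P : X → X} (hP : ∀ x : X, P x = if ‖x‖ ≤ 1 then x else ‖x‖⁻¹ • x)
    (x : X) {z : X} (hz : ‖z‖ ≤ 1) :
    0 ≤ ⟪x - P x, P x - z⟫ := by
  rw [hP]
  split_ifs with h
  · simp
  · have h1 : 1 < ‖x‖ := not_le.mp h
    have hn : ‖x‖ ≠ 0 := by positivity
    have hx : x - ‖x‖⁻¹ • x = (1 - ‖x‖⁻¹) • x := by module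
    have hle : ‖x‖⁻¹ ≤ 1 := inv_le_one_of_one_le₀ h1.le
    have hi : ‖x‖⁻¹ * ‖x‖ ^ 2 = ‖x‖ := by field_simp
    rw [hx, real_inner_smul_left, inner_sub_right, real_inner_smul_right,
      real_inner_self_eq_norm_sq, hi]
    have hcs : ⟪x, z⟫ ≤ ‖x‖ * ‖z‖ := real_inner_le_norm x z
    have hxz : ‖x‖ * ‖z‖ ≤ ‖x‖ := mul_le_of_le_one_right (norm_nonneg x) hz
    exact mul_nonneg (by linarith) (by linarith)

theorem subgradient_projector_of_huber_function
    {X : Type*} [NormedAddCommGroup X] [InnerProductSpace ℝ X] [CompleteSpace X]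
    (f : X → ℝ) (hf : ∀ x : X, f x = if ‖x‖ ≤ 1 then ‖x‖ ^ 2 / 2 else ‖x‖ - 1 / 2)
    (s : X → X) (hs : ∀ x : X, s x = if ‖x‖ ≤ 1 then x else ‖x‖⁻¹ • x)
    (P : X → X) (hP : ∀ x : X, P x = if ‖x‖ ≤ 1 then x else ‖x‖⁻¹ • x)
    (G : X → X)
    (hG : ∀ x : X, G x = if 0 < f x then x - (f x / ‖s x‖ ^ 2) • s x else x) :
    (∀ x : X, G x = (1 / 2 : ℝ) • P x) ∧
      ∀ x y : X, ‖G x - G y‖ ^ 2 + ‖(x - G x) - (y - G y)‖ ^ 2 ≤ ‖x - y‖ ^ 2 := by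
  have hGP : ∀ x : X, G x = (1 / 2 : ℝ) • P x := fun x => by
    rw [hG, huber_step_eq_half_unitBall_projection hf hs, hs, hP]
  refine ⟨hGP, fun x y => ?_⟩
  have hx := inner_sub_unitBall_projection_nonneg hP x (norm_unitBall_projection_le_one hP y)
  have hy := inner_sub_unitBall_projection_nonneg hP y (norm_unitBall_projection_le_one hP x)
  have hfirm : ‖P x - P y‖ ^ 2 ≤ ⟪x - y, P x - P y⟫ := by
    rw [← real_inner_self_eq_norm_sq]
    simp only [inner_sub_left, inner_sub_right] at hx hy ⊢
    linarith
  have h1 : G x - G y = (1 / 2 : ℝ) • (P x - P y) := by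
    rw [hGP, hGP, smul_sub]
  have h2 : (x - G x) - (y - G y) = (x - y) - (1 / 2 : ℝ) • (P x - P y) := by
    rw [← h1]
    abel
  rw [h2, h1, norm_sub_sq_real, real_inner_smul_right, norm_smul, mul_pow]
  norm_num
  nlinarith [sq_nonneg ‖P x - P y‖]
end

section
/- Let C be a nonempty closed convex subset of X, let p ≥ 1, and suppose f = d_C^p, the p-th power of the distance function to C. Then f is convex and continuous with {f ≤ 0} = C, and for every selection s of the subdifferential of f, the associated subgradient projector satisfies G = (1 − 1/p)·Id + (1/p)·P_C, where P_C is the metric projection onto C. -/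
open RealInnerProductSpace

theorem infDist_eq_norm_sub_of_forall_norm_le {X : Type*} [NormedAddCommGroup X] {C : Set X}
    {x q : X} (hq : q ∈ C) (hmin : ∀ c ∈ C, ‖x - q‖ ≤ ‖x - c‖) :
    Metric.infDist x C = ‖x - q‖ := by
  refine le_antisymm ?_ ((Metric.le_infDist ⟨q, hq⟩).2 fun c hc => ?_)
  · simpa [dist_eq_norm] using Metric.infDist_le_dist_of_mem (x := x) hq
  · simpa [dist_eq_norm] using hmin c hc

theorem convexOn_infDist {X : Type*} [NormedAddCommGroup X] [NormedSpace ℝ X] {C : Set X}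
    (hC : Convex ℝ C) (hne : C.Nonempty) :
    ConvexOn ℝ Set.univ fun x => Metric.infDist x C := by
  refine ⟨convex_univ, fun x _ y _ a b ha hb hab => le_of_forall_pos_le_add fun ε hε => ?_⟩
  obtain ⟨c, hc, hxc⟩ := (Metric.infDist_lt_iff hne).1 (lt_add_of_pos_right (Metric.infDist x C) hε)
  obtain ⟨d, hd, hyd⟩ := (Metric.infDist_lt_iff hne).1 (lt_add_of_pos_right (Metric.infDist y C) hε)
  rw [dist_eq_norm] at hxc hyd
  calc Metric.infDist (a • x + b • y) C
      ≤ ‖a • x + b • y - (a • c + b • d)‖ := by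
        rw [← dist_eq_norm]
        exact Metric.infDist_le_dist_of_mem (hC hc hd ha hb hab)
    _ = ‖a • (x - c) + b • (y - d)‖ := by congr 1; module
    _ ≤ a * ‖x - c‖ + b * ‖y - d‖ := by
        refine (norm_add_le _ _).trans ?_
        rw [norm_smul_of_nonneg ha, norm_smul_of_nonneg hb]
    _ ≤ a * (Metric.infDist x C + ε) + b * (Metric.infDist y C + ε) := by gcongr
    _ = a • Metric.infDist x C + b • Metric.infDist y C + ε := by
        simp only [smul_eq_mul]
        linear_combination ε * hab

theorem hasFDerivAt_norm_rpow_of_ne_zero {X : Type*} [NormedAddCommGroup X]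
    [InnerProductSpace ℝ X] {x : X} (hx : x ≠ 0) (p : ℝ) :
    HasFDerivAt (fun y : X => ‖y‖ ^ p) ((p * ‖x‖ ^ (p - 2)) • innerSL ℝ x) x := by
  have h := (hasStrictFDerivAt_norm_sq x).hasFDerivAt.rpow_const (p := p / 2)
    (Or.inl (pow_ne_zero 2 (norm_ne_zero_iff.2 hx)))
  have hpow (y : X) (q : ℝ) : (‖y‖ ^ 2) ^ (q / 2) = ‖y‖ ^ q := by
    rw [← Real.rpow_natCast, ← Real.rpow_mul (norm_nonneg y)]
    congr 1
    push_cast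
    ring
  simp only [hpow] at h
  convert h using 1
  rw [show p / 2 - 1 = (p - 2) / 2 by ring, hpow]
  module

/-- A convex-analysis subgradient of a function touched from above by `‖· - q‖ ^ p` at `x ≠ q`
is the gradient of that majorant. -/
theorem eq_smul_sub_of_subgradient_of_le_norm_rpow {X : Type*} [NormedAddCommGroup X]
    [InnerProductSpace ℝ X] {f : X → ℝ} {p : ℝ} {x q v : X} (hxq : x ≠ q)
    (hle : ∀ y, f y ≤ ‖y - q‖ ^ p) (hx : f x = ‖x - q‖ ^ p)
    (hv : ∀ y, f x + ⟪v, y - x⟫ ≤ f y) :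
    v = (p * ‖x - q‖ ^ (p - 2)) • (x - q) := by
  have hmin : IsLocalMin (fun y => ‖y - q‖ ^ p - ⟪v, y⟫) x := by
    refine Filter.Eventually.of_forall fun y => ?_
    have h₁ := hv y
    have h₂ := hle y
    rw [inner_sub_right] at h₁
    linarith
  have hd : HasFDerivAt (fun y => ‖y - q‖ ^ p - ⟪v, y⟫)
      ((p * ‖x - q‖ ^ (p - 2)) • innerSL ℝ (x - q) - innerSL ℝ v) x := by
    refine HasFDerivAt.sub ?_ (innerSL ℝ v).hasFDerivAt
    exact (hasFDerivAt_norm_rpow_of_ne_zero (sub_ne_zero.2 hxq) p).comp x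
      ((hasFDerivAt_id x).sub_const q)
  refine ext_inner_right ℝ fun w => ?_
  have h := DFunLike.congr_fun (hmin.hasFDerivAt_eq_zero hd) w
  simp only [sub_apply, smul_apply, innerSL_apply_apply,
    smul_eq_mul, zero_apply] at h
  rw [real_inner_smul_left]
  linarith

theorem subgradient_projector_of_power_of_distance
    {X : Type*} [NormedAddCommGroup X] [InnerProductSpace ℝ X] [CompleteSpace X]
    (C : Set X) (hCne : C.Nonempty) (hCclosed : IsClosed C) (hCconv : Convex ℝ C)
    (p : ℝ) (hp : 1 ≤ p)
    (f : X → ℝ) (hf : ∀ x : X, f x = Metric.infDist x C ^ p)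
    (PC : X → X)
    (hPC : ∀ x : X, PC x ∈ C ∧ ∀ c ∈ C, ‖x - PC x‖ ≤ ‖x - c‖) :
    ConvexOn ℝ Set.univ f ∧ Continuous f ∧ {x : X | f x ≤ 0} = C ∧
      ∀ s : X → X, (∀ x y : X, f x + ⟪s x, y - x⟫ ≤ f y) →
        ∀ G : X → X, (∀ x : X, G x = if 0 < f x then x - (f x / ‖s x‖ ^ 2) • s x else x) →
          ∀ x : X, G x = (1 - 1 / p) • x + (1 / p) • PC x := by
  have hp0 : 0 < p := by linarith
  have hdist (x : X) : Metric.infDist x C = ‖x - PC x‖ :=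
    infDist_eq_norm_sub_of_forall_norm_le (hPC x).1 (hPC x).2
  refine ⟨⟨convex_univ, fun x hx y hy a b ha hb hab => ?_⟩, ?_, ?_, fun s hs G hG x => ?_⟩
  · rw [hf, hf, hf]
    exact (Real.rpow_le_rpow Metric.infDist_nonneg
      ((convexOn_infDist hCconv hCne).2 hx hy ha hb hab) hp0.le).trans
      ((convexOn_rpow hp).2 Metric.infDist_nonneg Metric.infDist_nonneg ha hb hab)
  · rw [funext hf]
    exact (Metric.continuous_infDist_pt C).rpow_const fun _ => Or.inr hp0.le
  · ext x
    rw [Set.mem_ofPred_eq, hf, hCclosed.mem_iff_infDist_zero hCne,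
      (Real.rpow_nonneg Metric.infDist_nonneg p).ge_iff_eq',
      Real.rpow_eq_zero Metric.infDist_nonneg hp0.ne']
  · have hfx : f x = ‖x - PC x‖ ^ p := by rw [hf, hdist]
    rw [hG]
    obtain hx | hx := eq_or_ne x (PC x)
    · rw [if_neg (by rw [hfx, ← hx, sub_self, norm_zero, Real.zero_rpow hp0.ne']; exact lt_irrefl 0),
        ← hx]
      module
    · have hr : 0 < ‖x - PC x‖ := norm_pos_iff.2 (sub_ne_zero.2 hx)
      have hle (y : X) : f y ≤ ‖y - PC x‖ ^ p := by
        rw [hf, ← dist_eq_norm]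
        exact Real.rpow_le_rpow Metric.infDist_nonneg
          (Metric.infDist_le_dist_of_mem (hPC x).1) hp0.le
      have hpow : ‖x - PC x‖ ^ p = ‖x - PC x‖ ^ (p - 2) * ‖x - PC x‖ ^ 2 := by
        rw [← Real.rpow_natCast, ← Real.rpow_add hr]
        norm_num
      have ht : 0 < ‖x - PC x‖ ^ (p - 2) := Real.rpow_pos_of_pos hr _
      rw [if_pos (by rw [hfx]; positivity),
        eq_smul_sub_of_subgradient_of_le_norm_rpow hx hle hfx (hs x), hfx, hpow,
        norm_smul_of_nonneg (by positivity), smul_smul,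
        show ‖x - PC x‖ ^ (p - 2) * ‖x - PC x‖ ^ 2 /
            (p * ‖x - PC x‖ ^ (p - 2) * ‖x - PC x‖) ^ 2 * (p * ‖x - PC x‖ ^ (p - 2)) = 1 / p by
          field_simp]
      module
end

section
/- Let (xₙ) be a sequence in X converging strongly to a point x̄ and such that xₙ − Gxₙ → 0. Then x̄ ∈ C, i.e. f(x̄) ≤ 0. -/
open RealInnerProductSpace Filter

/-- Reflecting the subgradient projection `G x` through `x` gives a point where `f` is at least twice
its value at `x`. -/
theorem two_mul_le_apply_add_sub_subgradient_projection
    {X : Type*} [NormedAddCommGroup X] [InnerProductSpace ℝ X]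
    {f : X → ℝ} (hC : {x : X | f x ≤ 0}.Nonempty)
    {s : X → X} (hs : ∀ x y : X, f x + ⟪s x, y - x⟫ ≤ f y)
    {G : X → X}
    (hG : ∀ x : X, G x = if 0 < f x then x - (f x / ‖s x‖ ^ 2) • s x else x) (x : X) :
    2 * f x ≤ f (x + (x - G x)) := by
  rw [hG]
  split_ifs with hpos
  · have hne : s x ≠ 0 := by
      intro h0
      obtain ⟨c, hc⟩ := hC
      have h := hs x c
      rw [h0, inner_zero_left, add_zero] at h
      exact absurd (h.trans hc) hpos.not_ge
    rw [sub_sub_cancel]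
    have h := hs x (x + (f x / ‖s x‖ ^ 2) • s x)
    rwa [add_sub_cancel_left, real_inner_smul_right, real_inner_self_eq_norm_sq,
      div_mul_cancel₀ _ (pow_ne_zero 2 (norm_ne_zero_iff.mpr hne)), ← two_mul] at h
  · rw [sub_self, add_zero]
    linarith

theorem limit_of_sequence_with_vanishing_displacement_is_in_C
    {X : Type*} [NormedAddCommGroup X] [InnerProductSpace ℝ X] [CompleteSpace X]
    (f : X → ℝ) (hconv : ConvexOn ℝ Set.univ f) (hcont : Continuous f)
    (hC : {x : X | f x ≤ 0}.Nonempty)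
    (s : X → X) (hs : ∀ x y : X, f x + ⟪s x, y - x⟫ ≤ f y)
    (G : X → X)
    (hG : ∀ x : X, G x = if 0 < f x then x - (f x / ‖s x‖ ^ 2) • s x else x)
    (x : ℕ → X) (xbar : X)
    (hx : Tendsto x atTop (nhds xbar))
    (hdisp : Tendsto (fun n => x n - G (x n)) atTop (nhds 0)) :
    f xbar ≤ 0 := by
  have hlim : Tendsto (fun n => f (x n + (x n - G (x n)))) atTop (nhds (f xbar)) := by
    simpa [Function.comp_def] using (hcont.tendsto (xbar + 0)).comp (hx.add hdisp)
  have hle : 2 * f xbar ≤ f xbar :=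
    le_of_tendsto_of_tendsto' (((hcont.tendsto xbar).comp hx).const_mul 2) hlim
      fun n => two_mul_le_apply_add_sub_subgradient_projection hC hs hG (x n)
  linarith
end

section
/- The subgradient projector G is (norm-to-norm) continuous at every point of C. -/
open RealInnerProductSpace

/-- A subgradient step towards the zero sublevel set is no longer than the distance to any point
of that set. -/
theorem norm_subgradient_step_le {X : Type*} [NormedAddCommGroup X] [InnerProductSpace ℝ X]
    {a b : ℝ} {v x y : X} (ha : 0 < a) (hb : b ≤ 0) (h : a + ⟪v, y - x⟫ ≤ b) :
    ‖(a / ‖v‖ ^ 2) • v‖ ≤ ‖y - x‖ := by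
  have hle : a ≤ ‖v‖ * ‖y - x‖ := by
    have := neg_le_of_abs_le (abs_real_inner_le_norm v (y - x))
    linarith
  have hv : 0 < ‖v‖ := pos_of_mul_pos_left (ha.trans_le hle) (norm_nonneg _)
  calc ‖(a / ‖v‖ ^ 2) • v‖ = a / ‖v‖ := by
        rw [norm_smul, Real.norm_of_nonneg (by positivity)]
        field_simp
    _ ≤ ‖y - x‖ := by rwa [div_le_iff₀' hv]

theorem subgradient_projector_continuous_on_C
    {X : Type*} [NormedAddCommGroup X] [InnerProductSpace ℝ X] [CompleteSpace X]
    (f : X → ℝ) (hconv : ConvexOn ℝ Set.univ f) (hcont : Continuous f)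
    (hC : {x : X | f x ≤ 0}.Nonempty)
    (s : X → X) (hs : ∀ x y : X, f x + ⟪s x, y - x⟫ ≤ f y)
    (G : X → X)
    (hG : ∀ x : X, G x = if 0 < f x then x - (f x / ‖s x‖ ^ 2) • s x else x) :
    ∀ xbar : X, f xbar ≤ 0 → ContinuousAt G xbar := by
  intro xbar hxbar
  have hGbar : G xbar = xbar := by rw [hG, if_neg hxbar.not_gt]
  refine continuousAt_of_locally_lipschitz one_pos 2 fun x _ => ?_
  rw [hGbar, hG]
  split_ifs with hx
  · have hstep := norm_subgradient_step_le hx hxbar (hs x xbar)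
    calc dist (x - (f x / ‖s x‖ ^ 2) • s x) xbar
        ≤ dist (x - (f x / ‖s x‖ ^ 2) • s x) x + dist x xbar := dist_triangle _ _ _
      _ ≤ 2 * dist x xbar := by
          rw [dist_self_sub_left, dist_comm x, dist_eq_norm xbar]
          linarith
  · linarith [dist_nonneg (x := x) (y := xbar)]
end

section
/- Let x̄ ∈ X with f(x̄) > 0. Then f is Fréchet differentiable at x̄ if and only if the subgradient projector G is (norm-to-norm) continuous at x̄. -/
open RealInnerProductSpace

section Subgradient

open Filter Topology

variable {X : Type*} [NormedAddCommGroup X] [InnerProductSpace ℝ X] {f : X → ℝ} {s : X → X}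

/-- If a selection of the subdifferential is continuous at `x`, then the function is Fréchet
differentiable at `x`, with gradient `s x`. -/
theorem hasFDerivAt_of_continuousAt_subgradient_selection
    (hs : ∀ x y : X, f x + ⟪s x, y - x⟫ ≤ f y) {x : X} (h : ContinuousAt s x) :
    HasFDerivAt f (innerSL ℝ (s x)) x := by
  rw [hasFDerivAt_iff_isLittleO, Asymptotics.isLittleO_iff]
  intro c hc
  filter_upwards [Metric.continuousAt_iff'.1 h c hc] with y hy
  rw [dist_eq_norm] at hy
  have h1 := hs x y
  have h2 := hs y x
  have h3 : ⟪s y - s x, y - x⟫ ≤ c * ‖y - x‖ :=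
    (real_inner_le_norm _ _).trans (by gcongr)
  rw [← neg_sub y x, inner_neg_right] at h2
  rw [inner_sub_left] at h3
  rw [innerSL_apply_apply, Real.norm_eq_abs, abs_le]
  constructor <;> nlinarith [norm_nonneg (y - x)]

/-- The Fréchet derivative of a function is given by any of its subgradients. -/
theorem HasFDerivAt.eq_innerSL_of_subgradient {f' : X →L[ℝ] ℝ} {a x : X}
    (h : HasFDerivAt f f' x) (ha : ∀ y : X, f x + ⟪a, y - x⟫ ≤ f y) : f' = innerSL ℝ a := by
  have hmin : IsLocalMin (fun y => f y - innerSL ℝ a y) x := by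
    refine Eventually.of_forall fun y => ?_
    have := ha y
    rw [inner_sub_right] at this
    simp only [innerSL_apply_apply]
    linarith
  exact sub_eq_zero.1 (hmin.hasFDerivAt_eq_zero (h.sub (innerSL ℝ a).hasFDerivAt))

/-- If a function is Fréchet differentiable at `x`, then every selection of its subdifferential is
continuous at `x`. -/
theorem DifferentiableAt.continuousAt_subgradient_selection
    (hs : ∀ x y : X, f x + ⟪s x, y - x⟫ ≤ f y) {x : X} (h : DifferentiableAt ℝ f x) :
    ContinuousAt s x := by
  have hd := h.hasFDerivAt
  rw [hd.eq_innerSL_of_subgradient (hs x), hasFDerivAt_iff_isLittleO,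
    Asymptotics.isLittleO_iff] at hd
  rw [Metric.continuousAt_iff]
  intro ε hε
  obtain ⟨δ, hδ, hball⟩ := Metric.eventually_nhds_iff.1 (hd (show 0 < ε / 4 by positivity))
  refine ⟨δ / 2, by positivity, fun y hy => ?_⟩
  rw [dist_eq_norm] at hy ⊢
  set w := s y - s x with hw
  by_cases hw0 : w = 0
  · simpa [hw0] using hε
  have hwpos : 0 < ‖w‖ := norm_pos_iff.2 hw0
  set t := δ / 2 / ‖w‖ with ht
  have hnorm : ‖t • w‖ = δ / 2 := by
    rw [norm_smul, Real.norm_of_nonneg (by positivity), ht]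
    field_simp
  have hlt : ‖y + t • w - x‖ < δ := by
    rw [add_sub_right_comm]
    exact (norm_add_le _ _).trans_lt (by linarith)
  have h1 := hball ((dist_eq_norm (y + t • w) x).trans_lt hlt)
  rw [innerSL_apply_apply] at h1
  have h2 := (le_abs_self _).trans h1
  have h3 := hs y (y + t • w)
  have h4 := hs x y
  rw [add_sub_cancel_left] at h3
  rw [add_sub_right_comm y, inner_add_right, ← add_sub_right_comm y] at h2
  have h5 : ⟪w, t • w⟫ = δ / 2 * ‖w‖ := by
    rw [real_inner_smul_right, real_inner_self_eq_norm_sq, ht]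
    field_simp
  have h6 : ⟪w, t • w⟫ = ⟪s y, t • w⟫ - ⟪s x, t • w⟫ := by
    conv_lhs => rw [hw, inner_sub_left]
  have h7 : ε / 4 * ‖y + t • w - x‖ < ε / 4 * δ := by gcongr
  have h8 : δ / 2 * ‖w‖ < δ / 2 * ε := by linarith [mul_pos hε hδ]
  exact lt_of_mul_lt_mul_left h8 (by positivity)

/-- A subgradient at a point where the function is positive is nonzero, provided the function is
nonpositive somewhere. -/
theorem subgradient_ne_zero {a x : X} (hC : {x : X | f x ≤ 0}.Nonempty)
    (ha : ∀ y : X, f x + ⟪a, y - x⟫ ≤ f y) (hx : 0 < f x) : a ≠ 0 := by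
  rintro rfl
  obtain ⟨c, hc⟩ := hC
  have := ha c
  rw [inner_zero_left] at this
  rw [Set.mem_ofPred_eq] at hc
  linarith

/-- The map `v ↦ (r / ‖v‖ ^ 2) • v` is an involution for `r ≠ 0`. -/
theorem div_norm_sq_smul_div_norm_sq_smul {r : ℝ} (hr : r ≠ 0) (v : X) :
    (r / ‖(r / ‖v‖ ^ 2) • v‖ ^ 2) • (r / ‖v‖ ^ 2) • v = v := by
  rcases eq_or_ne v 0 with rfl | hv
  · simp
  have hv' : ‖v‖ ≠ 0 := norm_ne_zero_iff.2 hv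
  rw [smul_smul, norm_smul, mul_pow, Real.norm_eq_abs, sq_abs]
  convert one_smul ℝ v
  field_simp

theorem ContinuousAt.div_norm_sq_smul {v : X → X} {x : X} (hf : ContinuousAt f x)
    (hv : ContinuousAt v x) (hx : v x ≠ 0) :
    ContinuousAt (fun y => (f y / ‖v y‖ ^ 2) • v y) x :=
  (hf.div (hv.norm.pow 2) (pow_ne_zero 2 (norm_ne_zero_iff.2 hx))).smul hv

end Subgradient

theorem frechet_differentiability_iff_continuity_of_subgradient_projector
    {X : Type*} [NormedAddCommGroup X] [InnerProductSpace ℝ X] [CompleteSpace X]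
    (f : X → ℝ) (hconv : ConvexOn ℝ Set.univ f) (hcont : Continuous f)
    (hC : {x : X | f x ≤ 0}.Nonempty)
    (s : X → X) (hs : ∀ x y : X, f x + ⟪s x, y - x⟫ ≤ f y)
    (G : X → X)
    (hG : ∀ x : X, G x = if 0 < f x then x - (f x / ‖s x‖ ^ 2) • s x else x)
    (xbar : X) (hxbar : 0 < f xbar) :
    DifferentiableAt ℝ f xbar ↔ ContinuousAt G xbar := by
  have hpos : ∀ᶠ x in nhds xbar, 0 < f x := hcont.continuousAt.eventually (lt_mem_nhds hxbar)
  have hsne : s xbar ≠ 0 := subgradient_ne_zero hC (hs xbar) hxbar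
  constructor
  · intro h
    have hsc := h.continuousAt_subgradient_selection hs
    refine (continuousAt_id.sub (hcont.continuousAt.div_norm_sq_smul hsc hsne)).congr ?_
    filter_upwards [hpos] with x hx
    simp [hG x, hx]
  · intro h
    have hstep : ∀ x, 0 < f x → x - G x = (f x / ‖s x‖ ^ 2) • s x := fun x hx => by
      rw [hG x, if_pos hx, sub_sub_cancel]
    have hne : xbar - G xbar ≠ 0 := by
      rw [hstep xbar hxbar]
      exact smul_ne_zero (div_ne_zero hxbar.ne' (pow_ne_zero 2 (norm_ne_zero_iff.2 hsne))) hsne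
    have hsc : ContinuousAt s xbar := by
      refine (hcont.continuousAt.div_norm_sq_smul (continuousAt_id.sub h) hne).congr ?_
      filter_upwards [hpos] with x hx
      simp only [Pi.sub_apply, id_eq]
      rw [hstep x hx, div_norm_sq_smul_div_norm_sq_smul hx.ne']
    exact (hasFDerivAt_of_continuousAt_subgradient_selection hs hsc).differentiableAt
end

section
/- The subgradient projector G is (norm-to-norm) continuous everywhere on X if and only if f is Fréchet differentiable at every point of X \ C. -/
open RealInnerProductSpace

section Subgradient

open Filter Topology

variable {X : Type*} [NormedAddCommGroup X] [InnerProductSpace ℝ X] {f : X → ℝ} {s : X → X}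

theorem le_norm_mul_norm_sub_of_subgradient (hs : ∀ x y : X, f x + ⟪s x, y - x⟫ ≤ f y)
    {c : X} (hc : f c ≤ 0) (y : X) : f y ≤ ‖s y‖ * ‖y - c‖ := by
  have h1 := hs y c
  have h2 := real_inner_le_norm (s y) (y - c)
  rw [← neg_sub y c, inner_neg_right] at h1
  linarith

/-- A function is Fréchet differentiable wherever a selection of its subdifferential is
continuous. -/
theorem hasFDerivAt_of_continuousAt_subgradient (hs : ∀ x y : X, f x + ⟪s x, y - x⟫ ≤ f y)
    {x : X} (hx : ContinuousAt s x) : HasFDerivAt f (innerSL ℝ (s x)) x := by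
  refine .of_isLittleO (Asymptotics.isLittleO_iff.2 fun ε hε => ?_)
  filter_upwards [Metric.continuousAt_iff'.1 hx ε hε] with y hy
  rw [dist_eq_norm] at hy
  have h1 := hs x y
  have h2 := hs y x
  have h3 := real_inner_le_norm (s y - s x) (y - x)
  have h4 := mul_le_mul_of_nonneg_right hy.le (norm_nonneg (y - x))
  rw [← neg_sub y x, inner_neg_right] at h2
  rw [inner_sub_left] at h3
  rw [innerSL_apply_apply, Real.norm_eq_abs, abs_of_nonneg] <;> linarith

theorem fderiv_eq_innerSL_of_subgradient (hs : ∀ x y : X, f x + ⟪s x, y - x⟫ ≤ f y)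
    {x : X} {f' : X →L[ℝ] ℝ} (hf : HasFDerivAt f f' x) : f' = innerSL ℝ (s x) := by
  have hmin : IsLocalMin (fun y => f y - innerSL ℝ (s x) y) x := by
    refine Eventually.of_forall fun y => ?_
    have h := hs x y
    rw [inner_sub_right] at h
    simp only [innerSL_apply_apply]
    linarith
  exact sub_eq_zero.1
    (hmin.hasFDerivAt_eq_zero (hf.sub (innerSL ℝ (s x)).hasFDerivAt))

/-- Every selection of the subdifferential of a continuous function is continuous wherever the
function is Fréchet differentiable. -/
theorem continuousAt_subgradient_of_differentiableAt (hcont : Continuous f)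
    (hs : ∀ x y : X, f x + ⟪s x, y - x⟫ ≤ f y) {x : X} (hf : DifferentiableAt ℝ f x) :
    ContinuousAt s x := by
  have hd := hf.hasFDerivAt
  rw [fderiv_eq_innerSL_of_subgradient hs hd] at hd
  refine Metric.continuousAt_iff'.2 fun ε hε => ?_
  obtain ⟨r, hr, hball⟩ := Metric.eventually_nhds_iff.1
    (Asymptotics.isLittleO_iff.1 hd.isLittleO (half_pos hε))
  set δ := r / 2 with hδ
  have hδ0 : 0 < δ := half_pos hr
  have hg : ContinuousAt (fun y => f x + f ((2 : ℝ) • y - x) - 2 * f y) x := by fun_prop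
  have hlt : f x + f ((2 : ℝ) • x - x) - 2 * f x < δ * (ε / 2) := by
    rw [two_smul, add_sub_cancel_right]
    have := mul_pos hδ0 (half_pos hε)
    linarith
  filter_upwards [hg.eventually_lt_const hlt] with y hy
  rw [dist_eq_norm]
  rcases eq_or_ne (s y - s x) 0 with h0 | h0
  · rwa [h0, norm_zero]
  have hn : 0 < ‖s y - s x‖ := norm_pos_iff.2 h0
  set h : X := (δ / ‖s y - s x‖) • (s y - s x) with hh
  have hhn : ‖h‖ = δ := by
    rw [hh, norm_smul, Real.norm_of_nonneg (by positivity), div_mul_cancel₀ _ hn.ne']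
  have hin : ⟪s y - s x, h⟫ = δ * ‖s y - s x‖ := by
    rw [hh, real_inner_smul_right, real_inner_self_eq_norm_sq]
    field_simp
  have h1 : ‖f (x + h) - f x - innerSL ℝ (s x) (x + h - x)‖ ≤ ε / 2 * ‖x + h - x‖ := by
    refine hball ?_
    rw [dist_eq_norm, add_sub_cancel_left, hhn]
    linarith
  rw [add_sub_cancel_left, hhn, innerSL_apply_apply] at h1
  have h2 := (abs_le.1 h1).2
  have h3 := hs y (x + h)
  have h4 := hs y ((2 : ℝ) • y - x)
  rw [show x + h - y = h - (y - x) by abel, inner_sub_right] at h3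
  rw [show (2 : ℝ) • y - x - y = y - x by rw [two_smul]; abel] at h4
  rw [inner_sub_left] at hin
  refine lt_of_mul_lt_mul_left (?_ : δ * _ < δ * ε) hδ0.le
  linarith

end Subgradient

theorem subgradient_projector_continuous_iff_frechet_differentiable_outside_C
    {X : Type*} [NormedAddCommGroup X] [InnerProductSpace ℝ X] [CompleteSpace X]
    (f : X → ℝ) (hconv : ConvexOn ℝ Set.univ f) (hcont : Continuous f)
    (hC : {x : X | f x ≤ 0}.Nonempty)
    (s : X → X) (hs : ∀ x y : X, f x + ⟪s x, y - x⟫ ≤ f y)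
    (G : X → X)
    (hG : ∀ x : X, G x = if 0 < f x then x - (f x / ‖s x‖ ^ 2) • s x else x) :
    Continuous G ↔ ∀ x : X, 0 < f x → DifferentiableAt ℝ f x := by
  obtain ⟨c, hc⟩ := hC
  have hpos : ∀ y, 0 < f y → 0 < ‖s y‖ := fun y hy =>
    pos_of_mul_pos_left (hy.trans_le (le_norm_mul_norm_sub_of_subgradient hs hc y))
      (norm_nonneg _)
  have hnear : ∀ x, 0 < f x → ∀ᶠ y in nhds x, 0 < f y := fun x hx =>
    hcont.continuousAt.eventually_const_lt hx
  have hnorm : ∀ y, 0 < f y → ‖y - G y‖ = f y / ‖s y‖ := by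
    intro y hy
    have := hpos y hy
    rw [hG, if_pos hy, sub_sub_cancel, norm_smul, Real.norm_of_nonneg (by positivity)]
    field_simp
  constructor
  · intro hGc x hx
    refine (hasFDerivAt_of_continuousAt_subgradient hs ?_).differentiableAt
    have hne : ‖x - G x‖ ^ 2 ≠ 0 := by
      rw [hnorm x hx]
      have := hpos x hx
      positivity
    have hcs : ContinuousAt (fun y => (f y / ‖y - G y‖ ^ 2) • (y - G y)) x :=
      (hcont.continuousAt.div (by fun_prop) hne).smul (by fun_prop)
    refine hcs.congr ?_
    filter_upwards [hnear x hx] with y hy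
    have := hpos y hy
    rw [hnorm y hy, hG, if_pos hy, sub_sub_cancel, smul_smul]
    convert one_smul ℝ (s y) using 2
    field_simp
  · intro hd
    refine continuous_iff_continuousAt.2 fun x => ?_
    rcases lt_or_ge 0 (f x) with hx | hx
    · have hsx := continuousAt_subgradient_of_differentiableAt hcont hs (hd x hx)
      have hcg : ContinuousAt (fun y => y - (f y / ‖s y‖ ^ 2) • s y) x :=
        continuousAt_id.sub
          ((hcont.continuousAt.div (hsx.norm.pow 2) (pow_pos (hpos x hx) 2).ne').smul hsx)
      refine hcg.congr ?_
      filter_upwards [hnear x hx] with y hy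
      rw [hG, if_pos hy]
    · have hle : ∀ y, ‖y - G y‖ ≤ ‖y - x‖ := by
        intro y
        by_cases hy : 0 < f y
        · rw [hnorm y hy, div_le_iff₀' (hpos y hy)]
          exact le_norm_mul_norm_sub_of_subgradient hs hx y
        · rw [hG, if_neg hy, sub_self, norm_zero]
          exact norm_nonneg _
      have hGx : G x = x := by rw [hG, if_neg hx.not_gt]
      refine Metric.continuousAt_iff.2 fun ε hε => ⟨ε / 2, half_pos hε, fun {y} hy => ?_⟩
      have htri := dist_triangle (G y) y x
      have := hle y
      rw [← dist_eq_norm, ← dist_eq_norm, dist_comm] at this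
      rw [hGx]
      linarith
end

section
/- Suppose X = ℝ and f is twice differentiable at every point of ℝ \ C, with s(x) = f'(x) for x ∉ C. Then G is monotone (increasing): for all x, y ∈ ℝ, (x − y)(Gx − Gy) ≥ 0. -/
/-- The tangent line of a convex function lies below its graph. -/
theorem ConvexOn.add_mul_sub_le_of_hasDerivAt {f : ℝ → ℝ} (hconv : ConvexOn ℝ Set.univ f)
    {x d : ℝ} (hd : HasDerivAt f d x) (z : ℝ) : f x + d * (z - x) ≤ f z := by
  rcases lt_trichotomy x z with h | rfl | h
  · have := hconv.le_slope_of_hasDerivAt (Set.mem_univ x) (Set.mem_univ z) h hd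
    rw [slope_def_field, le_div_iff₀ (sub_pos.2 h)] at this
    linarith
  · simp
  · have := hconv.slope_le_of_hasDerivAt (Set.mem_univ z) (Set.mem_univ x) h hd
    rw [slope_def_field, div_le_iff₀ (sub_pos.2 h)] at this
    linarith

theorem subgradient_projector_monotone_on_real_line
    (f : ℝ → ℝ) (hconv : ConvexOn ℝ Set.univ f) (hcont : Continuous f)
    (hC : {x : ℝ | f x ≤ 0}.Nonempty)
    (f' f'' : ℝ → ℝ)
    (hf' : ∀ x : ℝ, 0 < f x → HasDerivAt f (f' x) x)
    (hf'' : ∀ x : ℝ, 0 < f x → HasDerivAt f' (f'' x) x)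
    (G : ℝ → ℝ)
    (hG : ∀ x : ℝ, G x = if 0 < f x then x - f x / f' x else x) :
    ∀ x y : ℝ, 0 ≤ (x - y) * (G x - G y) := by
  have tangent : ∀ x, 0 < f x → ∀ z, f x + f' x * (z - x) ≤ f z := fun x hx z =>
    hconv.add_mul_sub_le_of_hasDerivAt (hf' x hx) z
  have right : ∀ c x, f c ≤ 0 → 0 < f x → c < x → 0 < f' x ∧ c ≤ G x := by
    intro c x hc hx hcx
    have t := tangent x hx c
    have hd : 0 < f' x := by
      by_contra! h
      nlinarith
    refine ⟨hd, ?_⟩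
    rw [hG, if_pos hx, le_sub_comm, div_le_iff₀ hd]
    linarith
  have left : ∀ c x, f c ≤ 0 → 0 < f x → x < c → f' x < 0 ∧ G x ≤ c := by
    intro c x hc hx hxc
    have t := tangent x hx c
    have hd : f' x < 0 := by
      by_contra! h
      nlinarith
    refine ⟨hd, ?_⟩
    rw [hG, if_pos hx, sub_le_comm, le_div_iff_of_neg hd]
    linarith
  have mono : ∀ x y, x < y → G x ≤ G y := by
    intro x y hxy
    by_cases hx : 0 < f x <;> by_cases hy : 0 < f y
    · have tx := tangent x hx y
      have ty := tangent y hy x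
      have hd : f' x ≤ f' y := by
        by_contra! h
        nlinarith
      obtain ⟨c, hc : f c ≤ 0⟩ := hC
      rcases lt_trichotomy c x with h | rfl | h
      · have hdx := (right c x hc hx h).1
        have hdy := (right c y hc hy (h.trans hxy)).1
        rw [hG, hG, if_pos hx, if_pos hy]
        have h₁ : f x / f' y ≤ f x / f' x := div_le_div_of_nonneg_left hx.le hdx hd
        have h₂ : f y / f' y ≤ f x / f' y + (y - x) := by
          rw [div_add' _ _ _ hdy.ne']
          gcongr
          linarith
        linarith
      · exact absurd hx hc.not_gt
      · rcases lt_trichotomy c y with h' | rfl | h'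
        · exact (left c x hc hx h).2.trans (right c y hc hy h').2
        · exact absurd hy hc.not_gt
        · have hdx := (left c x hc hx h).1
          have hdy := (left c y hc hy h').1
          rw [hG, hG, if_pos hx, if_pos hy]
          have h₁ : f y / f' y ≤ f y / f' x := by
            rw [← neg_le_neg_iff, ← div_neg, ← div_neg]
            exact div_le_div_of_nonneg_left hy.le (neg_pos.2 hdy) (neg_le_neg hd)
          have h₂ : f y / f' x ≤ f x / f' x + (y - x) := by
            rw [div_add' _ _ _ hdx.ne]
            exact div_le_div_of_nonpos_of_le hdx.le (by linarith)
          linarith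
    · rw [hG y, if_neg hy]
      exact (left y x (not_lt.1 hy) hx hxy).2
    · rw [hG x, if_neg hx]
      exact (right x y (not_lt.1 hx) hy hxy).2
    · rw [hG, hG, if_neg hx, if_neg hy]
      exact hxy.le
  intro x y
  rcases lt_trichotomy x y with h | rfl | h
  · exact mul_nonneg_of_nonpos_of_nonpos (sub_nonpos.2 h.le) (sub_nonpos.2 (mono x y h))
  · simp
  · exact mul_nonneg (sub_nonneg.2 h.le) (sub_nonneg.2 (mono y x h))
end

section
/- Suppose X = ℝ and f is twice differentiable at every point of ℝ \ C, with s(x) = f'(x) for x ∉ C. Then G is nonexpansive (|Gx − Gy| ≤ |x − y| for all x, y ∈ ℝ) if and only if f(x)·f''(x) ≤ (f'(x))² for every x ∈ ℝ \ C. -/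
/-- A convex function on the real line lies above its tangent lines. -/
theorem ConvexOn.tangent_le_of_hasDerivAt {f : ℝ → ℝ} {m x : ℝ}
    (hconv : ConvexOn ℝ Set.univ f) (hf : HasDerivAt f m x) (z : ℝ) :
    f x + m * (z - x) ≤ f z := by
  rcases lt_trichotomy x z with h | rfl | h
  · have := hconv.le_slope_of_hasDerivAt (Set.mem_univ x) (Set.mem_univ z) h hf
    rw [slope_def_field, le_div_iff₀ (sub_pos.2 h)] at this
    linarith
  · simp
  · have := hconv.slope_le_of_hasDerivAt (Set.mem_univ z) (Set.mem_univ x) h hf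
    rw [slope_def_field, div_le_iff₀ (sub_pos.2 h)] at this
    linarith

/-- A Newton step for a convex function never overshoots a point of the sublevel set. -/
theorem ConvexOn.newton_step_mem_uIcc {f : ℝ → ℝ} {m x z : ℝ}
    (hconv : ConvexOn ℝ Set.univ f) (hf : HasDerivAt f m x) (hx : 0 < f x) (hz : f z ≤ 0) :
    m ≠ 0 ∧ x - f x / m ∈ Set.uIcc x z := by
  have ht := hconv.tangent_le_of_hasDerivAt hf z
  have hm : m ≠ 0 := by
    rintro rfl
    linarith
  refine ⟨hm, Set.mem_uIcc.2 ?_⟩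
  rcases hm.lt_or_gt with hm | hm
  · left
    have h₁ : f x / m ≤ 0 := div_nonpos_of_nonneg_of_nonpos hx.le hm.le
    have h₂ : x - z ≤ f x / m := by
      rw [le_div_iff_of_neg hm]
      linarith
    constructor <;> linarith
  · right
    have h₁ : 0 ≤ f x / m := div_nonneg hx.le hm.le
    have h₂ : f x / m ≤ x - z := by
      rw [div_le_iff₀ hm]
      linarith
    constructor <;> linarith

/-- The derivative of a function that is monotone around a point is nonnegative there. -/
theorem HasDerivAt.nonneg_of_eventually_mul_nonneg {g : ℝ → ℝ} {m x : ℝ} (hg : HasDerivAt g m x)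
    (h : ∀ᶠ y in nhds x, 0 ≤ (g y - g x) * (y - x)) : 0 ≤ m := by
  refine ge_of_tendsto (hasDerivAt_iff_tendsto_slope.1 hg) ?_
  filter_upwards [h.filter_mono nhdsWithin_le_nhds] with y hy
  rw [slope_def_field]
  exact div_nonneg_iff.2 (mul_nonneg_iff.1 hy)

theorem subgradient_projector_nonexpansive_iff_on_real_line
    (f : ℝ → ℝ) (hconv : ConvexOn ℝ Set.univ f) (hcont : Continuous f)
    (hC : {x : ℝ | f x ≤ 0}.Nonempty)
    (f' f'' : ℝ → ℝ)
    (hf' : ∀ x : ℝ, 0 < f x → HasDerivAt f (f' x) x)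
    (hf'' : ∀ x : ℝ, 0 < f x → HasDerivAt f' (f'' x) x)
    (G : ℝ → ℝ)
    (hG : ∀ x : ℝ, G x = if 0 < f x then x - f x / f' x else x) :
    (∀ x y : ℝ, |G x - G y| ≤ |x - y|) ↔
      ∀ x : ℝ, 0 < f x → f x * f'' x ≤ (f' x) ^ 2 := by
  obtain ⟨c, hc⟩ := hC
  have hne (x : ℝ) (hx : 0 < f x) : f' x ≠ 0 :=
    (hconv.newton_step_mem_uIcc (hf' x hx) hx hc).1
  have hmem (x z : ℝ) (hz : f z ≤ 0) : G x ∈ Set.uIcc x z := by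
    rw [hG]
    split_ifs with hx
    · exact (hconv.newton_step_mem_uIcc (hf' x hx) hx hz).2
    · exact Set.left_mem_uIcc
  have hpos (x : ℝ) (hx : 0 < f x) : ∀ᶠ y in nhds x, 0 < f y :=
    hcont.continuousAt.eventually (lt_mem_nhds hx)
  have hderiv (x : ℝ) (hx : 0 < f x) : HasDerivAt G (f x * f'' x / f' x ^ 2) x := by
    have h := (hasDerivAt_id x).sub ((hf' x hx).div (hf'' x hx) (hne x hx))
    have hval : f x * f'' x / f' x ^ 2 =
        1 - (f' x * f' x - f x * f'' x) / f' x ^ 2 := by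
      have := hne x hx
      field_simp
      ring
    rw [hval]
    refine h.congr_of_eventuallyEq ?_
    filter_upwards [hpos x hx] with y hy
    simp [hG, hy]
  constructor
  · intro h x hx
    have hle := (hderiv x hx).le_of_lip' (C := 1) zero_le_one
      (Filter.Eventually.of_forall fun y => by simpa using h y x)
    have := (le_abs_self _).trans hle
    rwa [div_le_one (sq_pos_of_ne_zero (hne x hx))] at this
  · intro h
    have hsecond (x : ℝ) (hx : 0 < f x) : 0 ≤ f'' x := by
      refine (hf'' x hx).nonneg_of_eventually_mul_nonneg ?_
      filter_upwards [hpos x hx] with y hy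
      have h₁ := hconv.tangent_le_of_hasDerivAt (hf' x hx) y
      have h₂ := hconv.tangent_le_of_hasDerivAt (hf' y hy) x
      linarith
    intro x y
    wlog hxy : x ≤ y generalizing x y
    · rw [abs_sub_comm, abs_sub_comm x]
      exact this y x (le_of_not_ge hxy)
    by_cases hz : ∃ z ∈ Set.Icc x y, f z ≤ 0
    · obtain ⟨z, ⟨hxz, hzy⟩, hz⟩ := hz
      have hGx := hmem x z hz
      have hGy := hmem y z hz
      rw [Set.uIcc_of_le hxz] at hGx
      rw [Set.uIcc_of_ge hzy] at hGy
      rw [abs_sub_comm, abs_sub_comm x, abs_of_nonneg (sub_nonneg.2 (hGx.2.trans hGy.1)),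
        abs_of_nonneg (sub_nonneg.2 hxy)]
      linarith [hGx.1, hGy.2]
    · push Not at hz
      have := (convex_Icc x y).norm_image_sub_le_of_norm_hasDerivWithin_le (C := 1)
        (fun t ht => (hderiv t (hz t ht)).hasDerivWithinAt)
        (fun t ht => by
          have hft := hz t ht
          have hsq : 0 < f' t ^ 2 := by
            have := hne t hft
            positivity
          rw [Real.norm_of_nonneg
            (div_nonneg (mul_nonneg hft.le (hsecond t hft)) hsq.le), div_le_one hsq]
          exact h t hft)
        (Set.right_mem_Icc.2 hxy) (Set.left_mem_Icc.2 hxy)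
      simpa using this
end

section
/- Let y ∈ X, let y* be a subgradient of f at y, and let w ∈ X belong to the recession cone of C, i.e. c + t·w ∈ C for every c ∈ C and every t ≥ 0. Then ⟨y*, w⟩ ≤ 0. Consequently, for every x ∈ X, ⟨x − Gx, w⟩ ≤ 0. -/
open RealInnerProductSpace

/-- A subgradient of `f` has nonpositive inner product with the direction `w` of any ray
`{c + t • w | 0 ≤ t}` on which `f ≤ 0`. -/
theorem inner_nonpos_of_subgradient_of_recession
    {X : Type*} [NormedAddCommGroup X] [InnerProductSpace ℝ X] {f : X → ℝ} {c w y v : X}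
    (hv : ∀ z : X, f y + ⟪v, z - y⟫ ≤ f z)
    (hw : ∀ t : ℝ, 0 ≤ t → f (c + t • w) ≤ 0) : ⟪v, w⟫ ≤ 0 := by
  by_contra! hpos
  set a := f y + ⟪v, c - y⟫
  have ht : 0 ≤ (|a| + 1) / ⟪v, w⟫ := by positivity
  have h := (hv _).trans (hw _ ht)
  rw [add_sub_right_comm, inner_add_right, real_inner_smul_right,
    div_mul_cancel₀ _ hpos.ne'] at h
  linarith [neg_abs_le a]

theorem subgradients_polar_to_recession_cone
    {X : Type*} [NormedAddCommGroup X] [InnerProductSpace ℝ X] [CompleteSpace X]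
    (f : X → ℝ) (hconv : ConvexOn ℝ Set.univ f) (hcont : Continuous f)
    (hC : {x : X | f x ≤ 0}.Nonempty)
    (s : X → X) (hs : ∀ x y : X, f x + ⟪s x, y - x⟫ ≤ f y)
    (G : X → X)
    (hG : ∀ x : X, G x = if 0 < f x then x - (f x / ‖s x‖ ^ 2) • s x else x)
    (y ystar : X) (hystar : ∀ z : X, f y + ⟪ystar, z - y⟫ ≤ f z)
    (w : X) (hw : ∀ c : X, f c ≤ 0 → ∀ t : ℝ, 0 ≤ t → f (c + t • w) ≤ 0) :
    ⟪ystar, w⟫ ≤ 0 ∧ ∀ x : X, ⟪x - G x, w⟫ ≤ 0 := by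
  obtain ⟨c, hc⟩ := hC
  have key : ∀ y v : X, (∀ z : X, f y + ⟪v, z - y⟫ ≤ f z) → ⟪v, w⟫ ≤ 0 :=
    fun _ _ hv => inner_nonpos_of_subgradient_of_recession hv (hw c hc)
  refine ⟨key y ystar hystar, fun x => ?_⟩
  rw [hG]
  split_ifs with hx
  · rw [sub_sub_cancel, real_inner_smul_left]
    exact mul_nonpos_of_nonneg_of_nonpos (by positivity) (key x (s x) (hs x))
  · simp
end

section
/- If for every x ∈ X the point Gx lies in the convex hull of {x} ∪ C, then f has the decreasing property: f(Gx) ≤ f(x) for every x ∈ X. -/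
open RealInnerProductSpace

theorem decreasing_property_of_subgradient_projector_under_convex_hull_condition
    {X : Type*} [NormedAddCommGroup X] [InnerProductSpace ℝ X] [CompleteSpace X]
    (f : X → ℝ) (hconv : ConvexOn ℝ Set.univ f) (hcont : Continuous f)
    (hC : {x : X | f x ≤ 0}.Nonempty)
    (s : X → X) (hs : ∀ x y : X, f x + ⟪s x, y - x⟫ ≤ f y)
    (G : X → X)
    (hG : ∀ x : X, G x = if 0 < f x then x - (f x / ‖s x‖ ^ 2) • s x else x)
    (hhull : ∀ x : X, G x ∈ convexHull ℝ ({x} ∪ {z : X | f z ≤ 0})) :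
    ∀ x : X, f (G x) ≤ f x := by
  intro x
  by_cases hx : 0 < f x
  · have hsub : {x} ∪ {z : X | f z ≤ 0} ⊆ {z ∈ Set.univ | f z ≤ f x} := by
      rintro z (rfl | hz)
      · exact ⟨Set.mem_univ _, le_rfl⟩
      · exact ⟨Set.mem_univ _, le_trans hz hx.le⟩
    exact (convexHull_min hsub (hconv.convex_le (f x)) (hhull x)).2
  · rw [hG x, if_neg hx]
end

section
/- Suppose X = ℝ. Then f has the decreasing property: f(Gx) ≤ f(x) for every x ∈ ℝ. -/
theorem decreasing_property_on_real_line
    (f : ℝ → ℝ) (hconv : ConvexOn ℝ Set.univ f) (hcont : Continuous f)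
    (hC : {x : ℝ | f x ≤ 0}.Nonempty)
    (s : ℝ → ℝ) (hs : ∀ x y : ℝ, f x + s x * (y - x) ≤ f y)
    (G : ℝ → ℝ)
    (hG : ∀ x : ℝ, G x = if 0 < f x then x - f x / s x else x) :
    ∀ x : ℝ, f (G x) ≤ f x := by
  intro x
  obtain ⟨c, hc : f c ≤ 0⟩ := hC
  by_cases hx : 0 < f x
  · have hxc := hs x c
    have hsx : s x ≠ 0 := by
      intro h
      rw [h] at hxc
      linarith
    have hGx : s x * (x - G x) = f x := by
      rw [hG, if_pos hx]
      field_simp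
      ring
    by_contra! hlt
    have hGc := hs (G x) c
    have hGx' := hs (G x) x
    have hsub_x : s (G x) * (x - G x) < 0 := by linarith
    have hsub_c : s (G x) * (c - G x) < 0 := by linarith
    -- `G x` lies between `c` and `x`, so the slope at `G x` cannot be descending towards both.
    have hbetween : 0 ≤ s x * (G x - c) := by linarith
    have hpos : 0 < s x * (x - G x) := hGx ▸ hx
    rcases lt_or_gt_of_ne hsx with h | h
    · have h₁ : x - G x < 0 := neg_of_mul_pos_right hpos h.le
      have h₂ : G x - c ≤ 0 := nonpos_of_mul_nonneg_right hbetween h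
      nlinarith
    · have h₁ : 0 < x - G x := pos_of_mul_pos_right hpos h.le
      have h₂ : 0 ≤ G x - c := nonneg_of_mul_nonneg_right hbetween h
      nlinarith
  · rw [hG, if_neg hx]
end

section
/- Suppose f is strictly convex at a point x ∈ X, meaning that f((1 − λ)x + λy) < (1 − λ)f(x) + λf(y) for every y ∈ X with y ≠ x and every λ ∈ (0,1), and suppose f(x) > 0. Then f(Gx) > 0. -/
open RealInnerProductSpace

theorem subgradient_projector_stays_outside_C_at_strictly_convex_point
    {X : Type*} [NormedAddCommGroup X] [InnerProductSpace ℝ X] [CompleteSpace X]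
    (f : X → ℝ) (hconv : ConvexOn ℝ Set.univ f) (hcont : Continuous f)
    (hC : {x : X | f x ≤ 0}.Nonempty)
    (s : X → X) (hs : ∀ x y : X, f x + ⟪s x, y - x⟫ ≤ f y)
    (G : X → X)
    (hG : ∀ x : X, G x = if 0 < f x then x - (f x / ‖s x‖ ^ 2) • s x else x)
    (x : X)
    (hstrict : ∀ y : X, y ≠ x → ∀ l : ℝ, 0 < l → l < 1 →
      f ((1 - l) • x + l • y) < (1 - l) * f x + l * f y)
    (hx : 0 < f x) :
    0 < f (G x) := by
  have hsx : s x ≠ 0 := by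
    intro h0
    obtain ⟨c, hc⟩ := hC
    have hc' : f c ≤ 0 := hc
    have h := hs x c
    rw [h0, inner_zero_left] at h
    linarith
  have hinner : ⟪s x, G x - x⟫ = -f x := by
    have hn : ‖s x‖ ≠ 0 := norm_ne_zero_iff.mpr hsx
    rw [hG x, if_pos hx, sub_sub_cancel_left, inner_neg_right, real_inner_smul_right,
      real_inner_self_eq_norm_sq]
    field_simp
  have hne : G x ≠ x := by
    intro h
    rw [h, sub_self, inner_zero_right] at hinner
    linarith
  have hmid := hstrict (G x) hne (1 / 2) (by norm_num) (by norm_num)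
  have hsub := hs x ((1 - 1 / 2 : ℝ) • x + (1 / 2 : ℝ) • G x)
  have hdiff : (1 - 1 / 2 : ℝ) • x + (1 / 2 : ℝ) • G x - x = (1 / 2 : ℝ) • (G x - x) := by
    module
  rw [hdiff, real_inner_smul_right, hinner] at hsub
  linarith
end
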